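/- For every n ≥ 2, every (n−2)-vector β ∈ Λ^{n−2}(ℝ^n), and all (n−1)-forms η̃, η̃' ∈ Λ^{n−1}(ℝ^n)*, one has (ι_β η̃) ∧ η̃' + (ι_β η̃') ∧ η̃ = 0 in Λ^n(ℝ^n)*. (This is the key multilinear identity showing that the β-type generators of the decomposition so(n,n) ⊃ gl(n) ⊕ Λ^{n−2}ℝ^n ⊕ Λ^{n−2}(ℝ^n)* act skew-adjointly with respect to the Spin(n,n)-invariant pairing on X.) -/

import Mathlib

open scoped BigOperators

noncomputable section

/-- `ℝ^n` -/
abbrev Vn (n : ℕ) : Type := Fin n → ℝ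

/-- alternating `k`-forms on `ℝ^n`, i.e. `Λ^k (ℝ^n)^*` (also used as a model of the space
`Λ^k ℝ^n` of `k`-vectors, a `k`-vector being recorded through its components
`β^{i_1…i_k} = β(e_{i_1},…,e_{i_k})` with respect to the standard basis). -/
abbrev Form (n k : ℕ) : Type := (Vn n) [⋀^Fin k]→ₗ[ℝ] ℝ

/-- the standard basis vector `e_m` of `ℝ^n` -/
def ee {n : ℕ} (m : Fin n) : Vn n := Pi.single m 1

/-- the determinant (volume) form `vol = dy^1 ∧ ⋯ ∧ dy^n` -/
def vol (n : ℕ) : Form n n := (Pi.basisFun ℝ (Fin n)).det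

/-- regard a covector as a `1`-form -/
def oneForm {n : ℕ} (α : Module.Dual ℝ (Vn n)) : Form n 1 :=
  AlternatingMap.ofSubsingleton ℝ (Vn n) ℝ (0 : Fin 1) α

/-- the dual basis covector `dy^m`, as a `1`-form -/
def dy {n : ℕ} (m : Fin n) : Form n 1 := oneForm (LinearMap.proj m)

/-- re-index a form along an equality of degrees -/
def Form.castDeg {n a b : ℕ} (h : a = b) (ω : Form n a) : Form n b :=
  ω.domDomCongr (finCongr h)

/-- the wedge product of alternating forms (shuffle convention, so that
`dy^1 ∧ ⋯ ∧ dy^n = vol` and `(α ∧ ω)(v_0,…,v_k) = ∑_i (-1)^i α(v_i) ω(v_0,…,v̂_i,…,v_k)`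
for a `1`-form `α`) -/
def wedge {n a b : ℕ} (ω : Form n a) (τ : Form n b) : Form n (a + b) :=
  ((TensorProduct.lid ℝ ℝ).toLinearMap.compAlternatingMap (ω.domCoprod τ)).domDomCongr
    finSumFinEquiv

/-- the interior product `ι_{e_m} ω = ω(e_m, ·, …, ·)`; `ι_{e_m} vol` is the flat-space
Hodge dual `⋆ dy^m` -/
def iotaE {n k : ℕ} (m : Fin n) (ω : Form n (k + 1)) : Form n k := ω.curryLeft (ee m)

/-- `W := (ℝ^n)^* ⊕ Λ^{n-1}(ℝ^n)^*`, for `n = N + 1` -/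
abbrev Wsp (N : ℕ) : Type := Form (N + 1) 1 × Form (N + 1) N

/-- the `Λ^n(ℝ^n)^*`-valued symmetric pairing `B((η,η̃),(η',η̃')) := η ∧ η̃' + η' ∧ η̃`
(the `Spin(n,n)`-invariant inner product on the bundle `X`). -/
def Bf {N : ℕ} (Y Y' : Wsp N) : Form (N + 1) (N + 1) :=
  Form.castDeg (Nat.add_comm 1 N) (wedge Y.1 Y'.2 + wedge Y'.1 Y.2)

/-- contraction of a list of `k` vectors into the first `k` arguments of a `(q+k)`-form -/
def mcontract {n : ℕ} : {k q : ℕ} → (Fin k → Vn n) → Form n (q + k) → Form n q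
  | 0, _, _, ω => ω
  | (k + 1), q, u, ω => mcontract (k := k) (q := q) (fun j => u j.succ) (ω.curryLeft (u 0))

/-- interior product `ι_β ω` of a `k`-vector `β` (given through its components
`β^{i_1…i_k} = β(e_{i_1},…,e_{i_k})`) into the first `k` arguments of a `(q+k)`-form `ω`:
`(ι_β ω) = (1/k!) ∑ β^{i_1…i_k} ω(e_{i_1},…,e_{i_k},·,…,·)`. -/
def contract {n k q : ℕ} (β : Form n k) (ω : Form n (q + k)) : Form n q :=
  ((Nat.factorial k : ℕ) : ℝ)⁻¹ • ∑ I : Fin k → Fin n,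
    β (fun j => ee (I j)) • mcontract (fun j => ee (I j)) ω

/-- `s(λ) := (-1)^{⌊p/2⌋} λ` on `p`-forms -/
def sform {n k : ℕ} (ω : Form n k) : Form n k := ((-1 : ℝ) ^ (k / 2)) • ω

/-- the derivation action `ρ(r)` of `r ∈ End(ℝ^n)` on forms, extending `α ↦ -α∘r`
on covectors; concretely `ρ(r)ω = -∑_{a,b} r^a{}_b · dy^b ∧ ι_{e_a}ω`. -/
def rho {n : ℕ} (r : Module.End ℝ (Vn n)) : {k : ℕ} → Form n k → Form n k
  | 0, _ => 0
  | (s + 1), ω =>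
      -∑ a : Fin n, ∑ b : Fin n,
        r (ee b) a • Form.castDeg (Nat.add_comm 1 s) (wedge (dy b) (ω.curryLeft (ee a)))

/-- the derivation action `ρ̂(r)` of `r ∈ End(ℝ^n)` on multivectors (represented through
their components as alternating maps), extending `v ↦ r v` on vectors;
concretely `ρ̂(r)β = ∑_{a,b} r^b{}_a · dy^b ∧ ι_{e_a}β` in the components model. -/
def rhoHat {n : ℕ} (r : Module.End ℝ (Vn n)) : {k : ℕ} → Form n k → Form n k
  | 0, _ => 0
  | (s + 1), β =>
      ∑ a : Fin n, ∑ b : Fin n,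
        r (ee a) b • Form.castDeg (Nat.add_comm 1 s) (wedge (dy b) (β.curryLeft (ee a)))

/-- the full contraction `⟨β, b⟩ = (1/k!) β^{i_1…i_k} b_{i_1…i_k}` -/
def fullContract {n k : ℕ} (β b : Form n k) : ℝ :=
  ((Nat.factorial k : ℕ) : ℝ)⁻¹ * ∑ I : Fin k → Fin n,
    β (fun j => ee (I j)) * b (fun j => ee (I j))

/-- the single-index partial contraction `C(β,b)^a{}_c = (1/m!) β^{a j_1…j_m} b_{c j_1…j_m}`
of a degree-`(m+1)` multivector `β` and form `b`, as an endomorphism of `ℝ^n`. -/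
def Cmat {n m : ℕ} (β b : Form n (m + 1)) : Module.End ℝ (Vn n) :=
  Matrix.toLin' (Matrix.of fun a c : Fin n =>
    ((Nat.factorial m : ℕ) : ℝ)⁻¹ * ∑ J : Fin m → Fin n,
      β (Fin.cons (ee a) fun j => ee (J j)) * b (Fin.cons (ee c) fun j => ee (J j)))

/-- the inner product on `k`-forms induced by the standard inner product of `ℝ^n`
(the `dy^{i_1} ∧ ⋯ ∧ dy^{i_k}`, `i_1 < ⋯ < i_k`, are orthonormal; equivalently on
`(n-1)`-forms it is the inner product making `ι_{e_1}vol, …, ι_{e_n}vol` orthonormal). -/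
def ipk {n k : ℕ} (ω ω' : Form n k) : ℝ :=
  ((Nat.factorial k : ℕ) : ℝ)⁻¹ * ∑ I : Fin k → Fin n,
    ω (fun j => ee (I j)) * ω' (fun j => ee (I j))

/-- `v` lies in the kernel of `ω`: the form vanishes as soon as one argument equals `v`. -/
def KillsForm {n k : ℕ} (v : Vn n) (ω : Form n k) : Prop :=
  ∀ (w : Fin k → Vn n) (i : Fin k), w i = v → ω w = 0

lemma KillsForm.castDeg {n a b : ℕ} {v : Vn n} {ω : Form n a} (hω : KillsForm v ω) (h : a = b) :
    KillsForm v (Form.castDeg h ω) := by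
  subst h
  exact hω

lemma KillsForm.mcontract {n : ℕ} {v : Vn n} {k q : ℕ} (u : Fin k → Vn n) {ω : Form n (q + k)}
    (hω : KillsForm v ω) : KillsForm v (mcontract u ω) := by
  induction k with
  | zero => exact hω
  | succ k ih =>
    refine ih (fun j => u j.succ) (ω := ω.curryLeft (u 0)) fun w i hi => ?_
    rw [AlternatingMap.curryLeft_apply_apply]
    exact hω _ i.succ (by simpa using hi)

lemma KillsForm.contract {n k q : ℕ} {v : Vn n} (β : Form n k) {ω : Form n (q + k)}
    (hω : KillsForm v ω) : KillsForm v (contract β ω) := by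
  have hsum : KillsForm v (∑ I : Fin k → Fin n,
      β (fun j => ee (I j)) • _root_.mcontract (fun j => ee (I j)) ω) := by
    refine Finset.sum_induction _ (KillsForm v) (fun σ τ hσ hτ w i hi => ?_)
      (fun _ _ _ => rfl) fun I _ w i hi => ?_
    · rw [AlternatingMap.add_apply, hσ w i hi, hτ w i hi, add_zero]
    · rw [AlternatingMap.smul_apply, hω.mcontract _ w i hi, smul_zero]
  intro w i hi
  rw [_root_.contract, AlternatingMap.smul_apply, hsum w i hi, smul_zero]

lemma KillsForm.wedge {n a b : ℕ} {v : Vn n} {ω : Form n a} {τ : Form n b}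
    (hω : KillsForm v ω) (hτ : KillsForm v τ) : KillsForm v (wedge ω τ) := by
  intro w i hi
  suffices h : ω.domCoprod τ (fun j => w (finSumFinEquiv j)) = 0 by
    simp [_root_.wedge, AlternatingMap.domDomCongr_apply, Function.comp_def, h]
  rw [AlternatingMap.domCoprod_apply, sum_apply]
  refine Finset.sum_eq_zero fun σ _ => ?_
  induction σ using Quotient.inductionOn' with | _ σ
  rw [AlternatingMap.domCoprod.summand_mk'', smul_apply,
    MultilinearMap.domDomCongr_apply, MultilinearMap.domCoprod_apply]
  obtain ⟨j, hj⟩ : ∃ j, finSumFinEquiv (σ j) = i :=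
    ⟨σ.symm (finSumFinEquiv.symm i), by simp⟩
  rcases j with j | j
  · have h := hω (fun j => w (finSumFinEquiv (σ (Sum.inl j)))) j (by rw [hj, hi])
    simp only [AlternatingMap.coe_multilinearMap, h, TensorProduct.zero_tmul, smul_zero]
  · have h := hτ (fun j => w (finSumFinEquiv (σ (Sum.inr j)))) j (by rw [hj, hi])
    simp only [AlternatingMap.coe_multilinearMap, h, TensorProduct.tmul_zero, smul_zero]

/-- A nonzero vector of `ℝ^(N + 1)` belongs to a basis. -/
lemma exists_basis_zero_eq {N : ℕ} {v : Vn (N + 1)} (hv : v ≠ 0) :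
    ∃ b : Module.Basis (Fin (N + 1)) ℝ (Vn (N + 1)), b 0 = v := by
  have h0 : Pi.basisFun ℝ (Fin (N + 1)) 0 ≠ 0 := (Pi.basisFun ℝ (Fin (N + 1))).ne_zero 0
  obtain ⟨A, hA⟩ := SeparatingDual.exists_continuousLinearEquiv_apply_eq (R := ℝ) h0 hv
  exact ⟨(Pi.basisFun ℝ (Fin (N + 1))).map A.toLinearEquiv, by simpa using hA⟩

/-- A top-degree form killed by a nonzero vector vanishes. -/
lemma KillsForm.eq_zero {N k : ℕ} (hk : k = N + 1) {v : Vn (N + 1)} (hv : v ≠ 0)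
    {ω : Form (N + 1) k} (hω : KillsForm v ω) : ω = 0 := by
  subst hk
  obtain ⟨b, hb⟩ := exists_basis_zero_eq hv
  rw [AlternatingMap.eq_smul_basis_det b ω, hω b 0 hb, zero_smul]

/-- Every form of codegree one is a contraction `ι_v vol`. -/
lemma curryLeft_vol_surjective (N : ℕ) : Function.Surjective (vol (N + 1)).curryLeft := by
  let e := exteriorPower.alternatingMapLinearEquiv (R := ℝ) (M := Vn (N + 1)) (N := ℝ) (n := N)
  have : Module.Finite ℝ (Form (N + 1) N) := Module.Finite.equiv e.symm
  have hdim : Module.finrank ℝ (Vn (N + 1)) = Module.finrank ℝ (Form (N + 1) N) := by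
    rw [e.finrank_eq, Module.finrank_linearMap_self, exteriorPower.finrank_eq]
    simp
  refine (LinearMap.injective_iff_surjective_of_finrank_eq_finrank hdim).1 ?_
  refine (injective_iff_map_eq_zero _).2 fun v hv => by_contra fun hne => ?_
  obtain ⟨b, hb⟩ := exists_basis_zero_eq hne
  have h : (vol (N + 1)).curryLeft v (Fin.tail b) = 0 := by rw [hv]; rfl
  rw [AlternatingMap.curryLeft_apply_apply, ← hb] at h
  change vol (N + 1) (Fin.cons (b 0) (Fin.tail b)) = 0 at h
  rw [Fin.cons_self_tail] at h
  exact ((Pi.basisFun ℝ (Fin (N + 1))).isUnit_det b).ne_zero h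

lemma exists_killsForm {N : ℕ} {ω : Form (N + 1) N} (hω : ω ≠ 0) :
    ∃ v : Vn (N + 1), v ≠ 0 ∧ KillsForm v ω := by
  obtain ⟨v, rfl⟩ := curryLeft_vol_surjective N ω
  refine ⟨v, fun h => hω (by rw [h, map_zero]), fun w i hi => ?_⟩
  rw [AlternatingMap.curryLeft_apply_apply]
  exact (vol (N + 1)).map_eq_zero_of_eq _ (i := 0) (j := i.succ) (by simp [hi])
    (Fin.succ_ne_zero i).symm

lemma mcontract_add {n k q : ℕ} (u : Fin k → Vn n) (ω τ : Form n (q + k)) :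
    mcontract u (ω + τ) = mcontract u ω + mcontract u τ := by
  induction k with
  | zero => rfl
  | succ k ih => exact ih (fun j => u j.succ) (ω.curryLeft (u 0)) (τ.curryLeft (u 0))

lemma contract_add {n k q : ℕ} (β : Form n k) (ω τ : Form n (q + k)) :
    contract β (ω + τ) = contract β ω + contract β τ := by
  simp only [contract, mcontract_add, smul_add, Finset.sum_add_distrib]

lemma add_wedge {n a b : ℕ} (ω ω' : Form n a) (τ : Form n b) :
    wedge (ω + ω') τ = wedge ω τ + wedge ω' τ := by
  simp only [wedge, ← AlternatingMap.domCoprod'_apply, TensorProduct.add_tmul, map_add]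
  ext w
  simp

lemma wedge_add {n a b : ℕ} (ω : Form n a) (τ τ' : Form n b) :
    wedge ω (τ + τ') = wedge ω τ + wedge ω τ' := by
  simp only [wedge, ← AlternatingMap.domCoprod'_apply, TensorProduct.tmul_add, map_add]
  ext w
  simp

lemma wedge_zero {n a b : ℕ} (ω : Form n a) : wedge ω (0 : Form n b) = 0 := by
  simpa using wedge_add ω (0 : Form n b) 0

/-- A form of codegree one wedges to zero with each of its contractions to a `1`-form: all
of these are killed by a common nonzero vector. -/
lemma contract_wedge_self (m : ℕ) (β : Form (m + 2) m) (ω : Form (m + 2) (m + 1)) :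
    wedge (contract β (Form.castDeg (Nat.add_comm m 1) ω)) ω = 0 := by
  by_cases hω : ω = 0
  · rw [hω, wedge_zero]
  · obtain ⟨v, hv, hk⟩ := exists_killsForm hω
    exact (((hk.castDeg _).contract β).wedge hk).eq_zero (Nat.add_comm 1 (m + 1)) hv

/-- For every `n ≥ 2` (written `n = m + 2`), every `(n-2)`-vector
`β ∈ Λ^{n-2}ℝ^n` (in the components model) and all `(n-1)`-forms `η̃, η̃'`, one has
`(ι_β η̃) ∧ η̃' + (ι_β η̃') ∧ η̃ = 0` in `Λ^n(ℝ^n)^*`. -/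
theorem contract_wedge_skew (m : ℕ) (β : Form (m + 2) m)
    (ηt ηt' : Form (m + 2) (m + 1)) :
    wedge (contract β (Form.castDeg (Nat.add_comm m 1) ηt)) ηt' +
      wedge (contract β (Form.castDeg (Nat.add_comm m 1) ηt')) ηt = 0 := by
  have h := contract_wedge_self m β (ηt + ηt')
  have hcast : Form.castDeg (Nat.add_comm m 1) (ηt + ηt') =
      Form.castDeg (Nat.add_comm m 1) ηt + Form.castDeg (Nat.add_comm m 1) ηt' := rfl
  rwa [hcast, contract_add, add_wedge, wedge_add, wedge_add, contract_wedge_self,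
    contract_wedge_self, zero_add, add_zero] at h

end
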